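/- Let X_1, …, X_n be independent under Ê with sup_{P ∈ 𝒫} E_P[|X_i|²] < ∞ for each i. Then Ê[ρ_Θ²((1/n)·∑_{i=1}^n X_i)] ≤ σ̄_n²/n, i.e. sup_{P ∈ 𝒫} E_P[dist((1/n)∑_{i=1}^n X_i, Θ)²] ≤ σ̄_n²/n. -/

import Mathlib

open MeasureTheory Set
open scoped NNReal ENNReal RealInnerProductSpace

noncomputable section

/-- Bounded Lipschitz real-valued function on a (pseudo)metric space. -/
def IsBLip {α : Type*} [PseudoMetricSpace α] (ψ : α → ℝ) : Prop :=
  (∃ K : ℝ≥0, LipschitzWith K ψ) ∧ ∃ C : ℝ, ∀ x, |ψ x| ≤ C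

variable {Ω : Type*} [MeasurableSpace Ω] [TopologicalSpace Ω]

/-- The sublinear expectation `Ê[f] = sup_{P ∈ Pset} E_P[f]`. -/
def hatE (Pset : Set (ProbabilityMeasure Ω)) (f : Ω → ℝ) : ℝ :=
  ⨆ P : Pset, ∫ ω, f ω ∂((P : ProbabilityMeasure Ω) : Measure Ω)

/-- Convexity of a set of probability measures. -/
def ConvexPM (Pset : Set (ProbabilityMeasure Ω)) : Prop :=
  ∀ P ∈ Pset, ∀ Q ∈ Pset, ∀ a : ℝ≥0, a ≤ 1 →
    ∃ R ∈ Pset, (R : Measure Ω)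
      = (a : ℝ≥0∞) • (P : Measure Ω) + ((1 - a : ℝ≥0) : ℝ≥0∞) • (Q : Measure Ω)

/-- `σ(X_1, …, X_i)` for a finite family of `ℝ^d`-valued maps (0-indexed:
`F X i` is generated by `X 0, …, X (i-1)`; `F X 0` is trivial). -/
def sigmaF {d n : ℕ} (X : Fin n → Ω → EuclideanSpace ℝ (Fin d)) (i : ℕ) :
    MeasurableSpace Ω :=
  ⨆ j : Fin n, ⨆ _ : (j : ℕ) < i, MeasurableSpace.comap (X j) (borel _)

/-- Independence of `X_1, …, X_n` (0-indexed) under the sublinear expectation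
associated with `Pset`. -/
def IndepUnder (Pset : Set (ProbabilityMeasure Ω)) {d n : ℕ}
    (X : Fin n → Ω → EuclideanSpace ℝ (Fin d)) : Prop :=
  ∀ (i : ℕ) (hi : i + 1 < n)
    (ψ : ((Fin (i + 1) → EuclideanSpace ℝ (Fin d)) × EuclideanSpace ℝ (Fin d)) → ℝ),
    IsBLip ψ →
    hatE Pset (fun ω => ψ ((fun j => X ⟨j.1, lt_trans j.2 hi⟩ ω), X ⟨i + 1, hi⟩ ω))
      = hatE Pset (fun ω =>
          hatE Pset (fun ω' => ψ ((fun j => X ⟨j.1, lt_trans j.2 hi⟩ ω), X ⟨i + 1, hi⟩ ω')))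

/-- Uniformly bounded second moments over `Pset`. -/
def HasBddMoment2 (Pset : Set (ProbabilityMeasure Ω)) {d : ℕ}
    (X : Ω → EuclideanSpace ℝ (Fin d)) : Prop :=
  ∃ C : ℝ, ∀ P ∈ Pset, Integrable (fun ω => ‖X ω‖ ^ 2) (P : Measure Ω) ∧
    ∫ ω, ‖X ω‖ ^ 2 ∂(P : Measure Ω) ≤ C

/-- `Θ_X = {θ : ⟨θ, p⟩ ≤ Ê[⟨p, X⟩] for all p}`. -/
def ThetaSet (Pset : Set (ProbabilityMeasure Ω)) {d : ℕ}
    (X : Ω → EuclideanSpace ℝ (Fin d)) : Set (EuclideanSpace ℝ (Fin d)) :=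
  {θ | ∀ p : EuclideanSpace ℝ (Fin d), ⟪θ, p⟫ ≤ hatE Pset (fun ω => ⟪p, X ω⟫)}

open Filter Topology

theorem integral_nonneg_iff_lintegral_ofReal_neg_le {Ω : Type*} [MeasurableSpace Ω]
    {P : Measure Ω} {U : Ω → ℝ} (hU : Integrable U P) : 0 ≤ ∫ ω, U ω ∂P ↔
      ∫⁻ ω, ENNReal.ofReal (-U ω) ∂P ≤ ∫⁻ ω, ENNReal.ofReal (U ω) ∂P := by
  rw [integral_eq_lintegral_pos_part_sub_lintegral_neg_part hU, sub_nonneg]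
  exact ENNReal.toReal_le_toReal hU.neg.lintegral_lt_top.ne hU.lintegral_lt_top.ne

/-- A real random variable whose integral against every nonnegative bounded Lipschitz function of
`Y` is nonnegative has nonnegative conditional expectation given `Y`. -/
theorem condExp_comap_nonneg_of_forall_isBLip {Ω S : Type*} [MeasurableSpace Ω]
    [PseudoMetricSpace S] [MeasurableSpace S] [BorelSpace S] {P : Measure Ω} [IsFiniteMeasure P]
    {Y : Ω → S} (hY : Measurable Y) {V : Ω → ℝ} (hVm : Measurable V) (hV : Integrable V P)
    (h : ∀ φ : S → ℝ, IsBLip φ → (∀ x, 0 ≤ φ x) → 0 ≤ ∫ ω, φ (Y ω) * V ω ∂P) :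
    0 ≤ᵐ[P] P[V | MeasurableSpace.comap Y inferInstance] := by
  let μ : (Ω → ℝ) → Measure S := fun U => (P.withDensity fun ω => ENNReal.ofReal (U ω)).map Y
  have hfin : ∀ U : Ω → ℝ, Integrable U P → IsFiniteMeasure (μ U) := fun U hU => by
    have := isFiniteMeasure_withDensity_ofReal hU.2
    exact Measure.isFiniteMeasure_map _ _
  have hset : ∀ U : Ω → ℝ, ∀ A, MeasurableSet A →
      μ U A = ∫⁻ ω in Y ⁻¹' A, ENNReal.ofReal (U ω) ∂P := fun U A hA => by
    simp only [μ]
    rw [Measure.map_apply hY hA, withDensity_apply _ (hY hA)]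
  have hlint : ∀ U : Ω → ℝ, Measurable U → ∀ g : BoundedContinuousFunction S ℝ≥0,
      ∫⁻ x, g x ∂μ U = ∫⁻ ω, ENNReal.ofReal (g (Y ω) * U ω) ∂P := fun U hU g => by
    have hg : Measurable fun x => (g x : ℝ≥0∞) := by fun_prop
    simp only [μ]
    rw [lintegral_map hg hY, lintegral_withDensity_eq_lintegral_mul _ (by fun_prop)
      (by fun_prop)]
    refine lintegral_congr fun ω => ?_
    rw [ENNReal.ofReal_mul (by positivity), ENNReal.ofReal_coe_nnreal, Pi.mul_apply, mul_comm]
  have := hfin V hV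
  have := hfin (-V) hV.neg
  have hclosed : ∀ F, IsClosed F → μ (-V) F ≤ μ V F := fun F hF => by
    have hpos : ∀ k : ℕ, (0 : ℝ) < 1 / ((k : ℝ) + 1) := fun k => by positivity
    refine le_of_tendsto_of_tendsto'
      (tendsto_lintegral_thickenedIndicator_of_isClosed (μ (-V)) hF hpos
        tendsto_one_div_add_atTop_nhds_zero_nat)
      (tendsto_lintegral_thickenedIndicator_of_isClosed (μ V) hF hpos
        tendsto_one_div_add_atTop_nhds_zero_nat) fun k => ?_
    set g := thickenedIndicator (hpos k) F
    have hg1 : ∀ x, ((g x : ℝ≥0) : ℝ) ≤ 1 := fun x =>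
      NNReal.coe_le_one.2 (thickenedIndicator_le_one (hpos k) F x)
    have hblip : IsBLip fun x => ((g x : ℝ≥0) : ℝ) := by
      refine ⟨⟨_, lipschitzWith_thickenedIndicator (hpos k) F⟩, 1, fun x => ?_⟩
      rw [abs_of_nonneg (by positivity)]; exact hg1 x
    have hgm : Measurable fun ω => ((g (Y ω) : ℝ≥0) : ℝ) := by
      have : Measurable g := g.continuous.measurable
      fun_prop
    have hint : Integrable (fun ω => ((g (Y ω) : ℝ≥0) : ℝ) * V ω) P :=
      hV.bdd_mul hgm.aestronglyMeasurable (c := 1) (Eventually.of_forall fun ω => by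
        rw [Real.norm_of_nonneg (by positivity)]; exact hg1 _)
    have h0 := h _ hblip fun x => by positivity
    rw [integral_nonneg_iff_lintegral_ofReal_neg_le hint] at h0
    rw [hlint _ hVm, hlint _ hVm.neg]
    simpa using h0
  have hle : ∀ A, MeasurableSet A → μ (-V) A ≤ μ V A := fun A hA => by
    rw [hA.measure_eq_iSup_isClosed_of_ne_top (measure_ne_top (μ (-V)) A)]
    exact iSup_le fun K => iSup_le fun hK => iSup_le fun hKc =>
      (hclosed K hKc).trans (measure_mono hK)
  have hm : MeasurableSpace.comap Y inferInstance ≤ ‹MeasurableSpace Ω› := hY.comap_le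
  refine ae_le_of_ae_le_trim (hm := hm) ?_
  refine ae_nonneg_of_forall_setIntegral_nonneg
    (integrable_condExp.trim hm stronglyMeasurable_condExp) fun s hs _ => ?_
  rw [← setIntegral_trim hm stronglyMeasurable_condExp hs, setIntegral_condExp hm hV hs]
  obtain ⟨A, hA, rfl⟩ := hs
  rw [integral_nonneg_iff_lintegral_ofReal_neg_le hV.integrableOn]
  simpa only [hset _ A hA, Pi.neg_apply] using hle A hA

/-- The inner product of two square-integrable functions is integrable. -/
theorem MeasureTheory.MemLp.integrable_inner_real {Ω E : Type*} [NormedAddCommGroup E]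
    [InnerProductSpace ℝ E] {m₀ : MeasurableSpace Ω} {P : Measure Ω} {f g : Ω → E}
    (hf : MemLp f 2 P) (hg : MemLp g 2 P) : Integrable (fun ω => ⟪f ω, g ω⟫) P :=
  (hf.norm.integrable_mul hg.norm).mono' (hf.1.inner hg.1)
    (Eventually.of_forall fun _ => norm_inner_le_norm _ _)

/-- The conditional expectation error is orthogonal to square-integrable conditioned variables. -/
theorem integral_inner_sub_condExp_eq_zero {Ω E : Type*} [NormedAddCommGroup E]
    [InnerProductSpace ℝ E] [CompleteSpace E] {m m₀ : MeasurableSpace Ω} (hm : m ≤ m₀)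
    {P : Measure Ω} [IsFiniteMeasure P] {X h : Ω → E} (hX : MemLp X 2 P) (hh : MemLp h 2 P)
    (hhm : StronglyMeasurable[m] h) : ∫ ω, ⟪h ω, X ω - (P[X | m]) ω⟫ ∂P = 0 := by
  have hD : MemLp (X - P[X | m]) 2 P := hX.sub (hX.condExp one_le_two)
  have hint : Integrable (fun ω => innerSL ℝ (h ω) ((X - P[X | m]) ω)) P :=
    hh.integrable_inner_real hD
  have h1 := condExp_bilin_of_stronglyMeasurable_left (innerSL ℝ) hhm hint
    (hD.integrable one_le_two)
  have h2 : P[X - P[X | m] | m] =ᵐ[P] 0 := by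
    refine (condExp_sub (hX.integrable one_le_two) integrable_condExp m).trans ?_
    rw [condExp_of_stronglyMeasurable hm stronglyMeasurable_condExp integrable_condExp, sub_self]
  calc ∫ ω, ⟪h ω, X ω - (P[X | m]) ω⟫ ∂P
      = ∫ ω, (P[fun ω => innerSL ℝ (h ω) ((X - P[X | m]) ω) | m]) ω ∂P :=
        (integral_condExp hm).symm
    _ = ∫ _, (0 : ℝ) ∂P := integral_congr_ae <| by
        filter_upwards [h1, h2] with ω h1 h2
        rw [h1, h2]; simp
    _ = 0 := integral_zero _ _

/-- The conditional expectation is a better mean-square predictor than any constant. -/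
theorem integral_norm_sub_condExp_sq_le {Ω E : Type*} [NormedAddCommGroup E]
    [InnerProductSpace ℝ E] [CompleteSpace E] {m m₀ : MeasurableSpace Ω} (hm : m ≤ m₀)
    {P : Measure Ω} [IsFiniteMeasure P] {X : Ω → E} (hX : MemLp X 2 P) (θ : E) :
    ∫ ω, ‖X ω - (P[X | m]) ω‖ ^ 2 ∂P ≤ ∫ ω, ‖X ω - θ‖ ^ 2 ∂P := by
  have hM : MemLp (P[X | m]) 2 P := hX.condExp one_le_two
  have hMθ : MemLp (fun ω => (P[X | m]) ω - θ) 2 P := hM.sub (memLp_const θ)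
  have hD : MemLp (fun ω => X ω - (P[X | m]) ω) 2 P := hX.sub hM
  have h0 := integral_inner_sub_condExp_eq_zero hm hX hMθ
    (stronglyMeasurable_condExp.sub stronglyMeasurable_const)
  have hi : Integrable (fun ω => ⟪(P[X | m]) ω - θ, X ω - (P[X | m]) ω⟫) P :=
    hMθ.integrable_inner_real hD
  have hD2 := hD.integrable_norm_pow two_ne_zero
  have hMθ2 := hMθ.integrable_norm_pow two_ne_zero
  have hexp : ∀ ω, ‖X ω - θ‖ ^ 2 = ‖X ω - (P[X | m]) ω‖ ^ 2
      + (2 * ⟪(P[X | m]) ω - θ, X ω - (P[X | m]) ω⟫ + ‖(P[X | m]) ω - θ‖ ^ 2) := fun ω => by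
    have : X ω - θ = ((P[X | m]) ω - θ) + (X ω - (P[X | m]) ω) := by abel
    rw [this, norm_add_sq_real]; ring
  have hrest : Integrable (fun ω => 2 * ⟪(P[X | m]) ω - θ, X ω - (P[X | m]) ω⟫
      + ‖(P[X | m]) ω - θ‖ ^ 2) P := (hi.const_mul 2).add hMθ2
  simp_rw [hexp]
  rw [integral_add hD2 hrest, integral_add (hi.const_mul 2) hMθ2,
    integral_const_mul, h0]
  have : 0 ≤ ∫ ω, ‖(P[X | m]) ω - θ‖ ^ 2 ∂P := integral_nonneg fun ω => by positivity
  linarith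

/-- The first `i` maps of a finite family, bundled into one map. -/
def pastMap {Ω E : Type*} {n : ℕ} (X : Fin n → Ω → E) (i : Fin n) (ω : Ω) : Fin i → E :=
  fun j => X ⟨j, j.2.trans i.2⟩ ω

theorem measurable_pastMap {Ω E : Type*} [MeasurableSpace Ω] [MeasurableSpace E] {n : ℕ}
    {X : Fin n → Ω → E} (hX : ∀ i, Measurable (X i)) (i : Fin n) : Measurable (pastMap X i) :=
  measurable_pi_lambda _ fun _ => hX _

theorem measurable_comap_pastMap {Ω E : Type*} [MeasurableSpace E] {n : ℕ}
    (X : Fin n → Ω → E) {i j : Fin n} (hij : i < j) :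
    Measurable[MeasurableSpace.comap (pastMap X j) inferInstance] (X i) :=
  (measurable_pi_apply (⟨i, hij⟩ : Fin j)).comp (comap_measurable (pastMap X j))

theorem comap_pastMap_mono {Ω E : Type*} [MeasurableSpace E] {n : ℕ}
    (X : Fin n → Ω → E) {i j : Fin n} (hij : i ≤ j) :
    MeasurableSpace.comap (pastMap X i) inferInstance
      ≤ MeasurableSpace.comap (pastMap X j) inferInstance := by
  let : MeasurableSpace Ω := MeasurableSpace.comap (pastMap X j) inferInstance
  refine Measurable.comap_le (measurable_pi_lambda _ fun k => ?_)
  exact measurable_comap_pastMap X (i := ⟨k, k.2.trans i.2⟩) (lt_of_lt_of_le k.2 hij)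

theorem le_hatE {Ω : Type*} [MeasurableSpace Ω] [TopologicalSpace Ω]
    {Pset : Set (ProbabilityMeasure Ω)} {f : Ω → ℝ} {C : ℝ}
    (hC : ∀ P ∈ Pset, ∫ ω, f ω ∂(P : Measure Ω) ≤ C) {P : ProbabilityMeasure Ω}
    (hP : P ∈ Pset) : ∫ ω, f ω ∂(P : Measure Ω) ≤ hatE Pset f :=
  le_ciSup (f := fun P : Pset => ∫ ω, f ω ∂((P : ProbabilityMeasure Ω) : Measure Ω))
    ⟨C, by rintro _ ⟨Q, rfl⟩; exact hC Q Q.2⟩ ⟨P, hP⟩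

theorem hatE_le {Ω : Type*} [MeasurableSpace Ω] [TopologicalSpace Ω]
    {Pset : Set (ProbabilityMeasure Ω)} (hne : Pset.Nonempty) {f : Ω → ℝ} {C : ℝ}
    (hC : ∀ P ∈ Pset, ∫ ω, f ω ∂(P : Measure Ω) ≤ C) : hatE Pset f ≤ C :=
  have := hne.to_subtype
  ciSup_le fun P => hC P P.2

theorem integral_le_of_abs_le {Ω : Type*} [MeasurableSpace Ω] {P : Measure Ω}
    [IsProbabilityMeasure P] {f : Ω → ℝ} {C : ℝ} (hC : ∀ ω, |f ω| ≤ C) : ∫ ω, f ω ∂P ≤ C := by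
  have : ‖∫ ω, f ω ∂P‖ ≤ C * P.real univ :=
    norm_integral_le_of_norm_le_const (Eventually.of_forall hC)
  simp only [probReal_univ, mul_one] at this
  exact (le_abs_self _).trans this

theorem IsBLip.continuous {α : Type*} [PseudoMetricSpace α] {ψ : α → ℝ} (h : IsBLip ψ) :
    Continuous ψ := h.1.choose_spec.continuous

theorem IsBLip.comp_lipschitz {α β : Type*} [PseudoMetricSpace α] [PseudoMetricSpace β]
    {ψ : α → ℝ} (h : IsBLip ψ) {g : β → α} {K : ℝ≥0} (hg : LipschitzWith K g) :
    IsBLip fun x => ψ (g x) := by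
  obtain ⟨⟨L, hL⟩, C, hC⟩ := h
  exact ⟨⟨_, hL.comp hg⟩, C, fun x => hC _⟩

theorem IsBLip.const_sub {α : Type*} [PseudoMetricSpace α] {ψ : α → ℝ} (h : IsBLip ψ) (c : ℝ) :
    IsBLip fun x => c - ψ x := by
  obtain ⟨⟨L, hL⟩, C, hC⟩ := h
  exact ⟨⟨_, (LipschitzWith.const c).sub hL⟩, |c| + C, fun x =>
    (abs_sub _ _).trans (add_le_add_right (hC x) _)⟩

theorem IsBLip.mul {α : Type*} [PseudoMetricSpace α] {φ ψ : α → ℝ} (hφ : IsBLip φ)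
    (hψ : IsBLip ψ) : IsBLip fun x => φ x * ψ x := by
  obtain ⟨⟨K, hK⟩, A, hA⟩ := hφ
  obtain ⟨⟨L, hL⟩, B, hB⟩ := hψ
  refine ⟨⟨A.toNNReal * L + B.toNNReal * K, LipschitzWith.of_dist_le_mul fun x y => ?_⟩, A * B,
    fun x => ?_⟩
  · have hA0 : 0 ≤ A := (abs_nonneg _).trans (hA x)
    have hB0 : 0 ≤ B := (abs_nonneg _).trans (hB x)
    have h1 := hK.dist_le_mul x y
    have h2 := hL.dist_le_mul x y
    rw [Real.dist_eq] at h1 h2 ⊢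
    push_cast
    rw [Real.coe_toNNReal _ hA0, Real.coe_toNNReal _ hB0]
    calc |φ x * ψ x - φ y * ψ y| = |φ x * (ψ x - ψ y) + ψ y * (φ x - φ y)| := by congr 1; ring
      _ ≤ |φ x| * |ψ x - ψ y| + |ψ y| * |φ x - φ y| := by
        rw [← abs_mul, ← abs_mul]; exact abs_add_le _ _
      _ ≤ A * (L * dist x y) + B * (K * dist x y) := by
        gcongr
        · exact hA x
        · exact hB y
      _ = _ := by ring
  · rw [abs_mul]
    exact mul_le_mul (hA x) (hB x) (abs_nonneg _) ((abs_nonneg _).trans (hA x))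

/-- Independence tested on a bounded Lipschitz function of the present map against a nonnegative
bounded Lipschitz function of the past maps. -/
theorem IndepUnder.integral_mul_nonneg {Ω : Type*} [TopologicalSpace Ω] [MeasurableSpace Ω]
    {d n : ℕ} {Pset : Set (ProbabilityMeasure Ω)} {X : Fin n → Ω → EuclideanSpace ℝ (Fin d)}
    (hmeas : ∀ i, Measurable (X i)) (hindep : IndepUnder Pset X) (i : Fin n)
    {f : EuclideanSpace ℝ (Fin d) → ℝ} (hf : IsBLip f)
    {φ : (Fin i → EuclideanSpace ℝ (Fin d)) → ℝ} (hφ : IsBLip φ) (hφ0 : ∀ x, 0 ≤ φ x)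
    {P : ProbabilityMeasure Ω} (hP : P ∈ Pset) :
    0 ≤ ∫ ω, φ (pastMap X i ω) * (hatE Pset (fun ω' => f (X i ω')) - f (X i ω))
      ∂(P : Measure Ω) := by
  set c := hatE Pset (fun ω' => f (X i ω'))
  obtain ⟨C, hC⟩ := hf.2
  have hfi : ∀ (Q : ProbabilityMeasure Ω), Integrable (fun ω => f (X i ω)) (Q : Measure Ω) :=
    fun Q => Integrable.of_bound (hf.continuous.measurable.comp (hmeas i)).aestronglyMeasurable C
      (Eventually.of_forall fun _ => hC _)
  have hconst : ∀ a : ℝ, 0 ≤ a → ∀ Q ∈ Pset,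
      0 ≤ ∫ ω, a * (c - f (X i ω)) ∂(Q : Measure Ω) := fun a ha Q hQ => by
    rw [integral_const_mul, integral_sub (integrable_const c) (hfi Q)]
    simp only [integral_const, probReal_univ, one_smul]
    exact mul_nonneg ha (sub_nonneg.2 (le_hatE (C := C)
      (fun R _ => integral_le_of_abs_le fun _ => hC _) hQ))
  obtain ⟨k, hk⟩ := i
  cases k with
  | zero =>
    have : ∀ ω, pastMap X ⟨0, hk⟩ ω = 0 := fun ω => funext fun j => j.elim0
    simp_rw [this]
    exact hconst _ (hφ0 _) P hP
  | succ k =>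
    have hψ : IsBLip fun z : (Fin (k + 1) → EuclideanSpace ℝ (Fin d)) ×
        EuclideanSpace ℝ (Fin d) => -1 * (φ z.1 * (c - f z.2)) :=
      IsBLip.mul ⟨⟨0, LipschitzWith.const _⟩, 1, fun _ => by simp⟩
        ((hφ.comp_lipschitz LipschitzWith.prod_fst).mul
          ((hf.comp_lipschitz LipschitzWith.prod_snd).const_sub c))
    obtain ⟨B, hB⟩ := hψ.2
    have key := le_hatE (Pset := Pset) (f := fun ω =>
      -1 * (φ (pastMap X ⟨k + 1, hk⟩ ω) * (c - f (X ⟨k + 1, hk⟩ ω))))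
      (fun R _ => integral_le_of_abs_le fun _ => hB (_, _)) hP
    have heq := hindep k hk _ hψ
    have hle : hatE Pset (fun ω => -1 * (φ (pastMap X ⟨k + 1, hk⟩ ω)
        * (c - f (X ⟨k + 1, hk⟩ ω)))) ≤ 0 := by
      refine heq.le.trans (Real.iSup_nonpos fun Q => integral_nonpos fun ω =>
        Real.iSup_nonpos fun R => ?_)
      rw [integral_const_mul]
      have := hconst _ (hφ0 (pastMap X ⟨k + 1, hk⟩ ω)) R R.2
      unfold pastMap at this
      linarith
    rw [integral_const_mul] at key
    linarith

theorem abs_sub_truncation_le (z : ℝ) {N : ℝ} (hN : 0 < N) :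
    |z - max (-N) (min z N)| ≤ 1 / N * z ^ 2 := by
  rw [one_div, inv_mul_eq_div, le_div_iff₀ hN]
  rcases le_total z N with h1 | h1
  · rw [min_eq_left h1]
    rcases le_total (-N) z with h2 | h2
    · rw [max_eq_right h2]; simp; positivity
    · rw [max_eq_left h2, abs_of_nonpos (by linarith)]; nlinarith
  · rw [min_eq_right h1, max_eq_right (by linarith), abs_of_nonneg (by linarith)]; nlinarith

/-- Independence tested on a Lipschitz function of the present map with uniformly bounded second
moments, against a nonnegative bounded Lipschitz function of the past maps. -/
theorem IndepUnder.integral_mul_nonneg_of_lipschitzWith {Ω : Type*} [TopologicalSpace Ω]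
    [MeasurableSpace Ω] {d n : ℕ} {Pset : Set (ProbabilityMeasure Ω)}
    {X : Fin n → Ω → EuclideanSpace ℝ (Fin d)} (hne : Pset.Nonempty)
    (hmeas : ∀ i, Measurable (X i)) (hindep : IndepUnder Pset X) (i : Fin n)
    {g : EuclideanSpace ℝ (Fin d) → ℝ} {L : ℝ≥0} (hg : LipschitzWith L g) {K : ℝ}
    (hK : ∀ P ∈ Pset, MemLp (fun ω => g (X i ω)) 2 (P : Measure Ω) ∧
      ∫ ω, g (X i ω) ^ 2 ∂(P : Measure Ω) ≤ K)
    {φ : (Fin i → EuclideanSpace ℝ (Fin d)) → ℝ} (hφ : IsBLip φ) (hφ0 : ∀ x, 0 ≤ φ x)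
    {P : ProbabilityMeasure Ω} (hP : P ∈ Pset) :
    0 ≤ ∫ ω, φ (pastMap X i ω) * (hatE Pset (fun ω' => g (X i ω')) - g (X i ω))
      ∂(P : Measure Ω) := by
  set c := hatE Pset (fun ω' => g (X i ω'))
  obtain ⟨B, hB⟩ := hφ.2
  have hB0 : 0 ≤ B := (abs_nonneg _).trans (hB 0)
  have hint : ∀ Q ∈ Pset, Integrable (fun ω => g (X i ω)) (Q : Measure Ω) :=
    fun Q hQ => (hK Q hQ).1.integrable one_le_two
  have hint2 : ∀ Q ∈ Pset, Integrable (fun ω => g (X i ω) ^ 2) (Q : Measure Ω) :=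
    fun Q hQ => (hK Q hQ).1.integrable_sq
  have hle_c : ∀ Q ∈ Pset, ∫ ω, g (X i ω) ∂(Q : Measure Ω) ≤ c := fun Q hQ => by
    refine le_hatE (C := 1 + K) (fun R hR => ?_) hQ
    calc ∫ ω, g (X i ω) ∂(R : Measure Ω) ≤ ∫ ω, (1 + g (X i ω) ^ 2) ∂(R : Measure Ω) :=
          integral_mono (hint R hR) ((integrable_const 1).add (hint2 R hR)) fun ω => by
            dsimp only
            nlinarith [sq_nonneg (g (X i ω) - 1)]
      _ ≤ 1 + K := by
          rw [integral_add (integrable_const 1) (hint2 R hR)]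
          simpa using (hK R hR).2
  have hbound : Integrable (fun ω => φ (pastMap X i ω) * (c - g (X i ω))) (P : Measure Ω) :=
    ((integrable_const c).sub (hint P hP)).bdd_mul (c := B)
      (hφ.continuous.measurable.comp (measurable_pastMap hmeas i)).aestronglyMeasurable
      (Eventually.of_forall fun _ => hB _)
  have key : ∀ k : ℕ, 0 ≤ ∫ ω, φ (pastMap X i ω) * (c - g (X i ω)) ∂(P : Measure Ω)
      + 2 * B * K * (1 / ((k : ℝ) + 1)) := fun k => by
    have hN : (0 : ℝ) < (k : ℝ) + 1 := by positivity
    set N : ℝ := (k : ℝ) + 1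
    set ε : ℝ := 1 / N
    have hε : 0 < ε := by positivity
    set T : EuclideanSpace ℝ (Fin d) → ℝ := fun y => max (-N) (min (g y) N)
    have hT : ∀ y, |g y - T y| ≤ ε * g y ^ 2 := fun y => abs_sub_truncation_le (g y) hN
    have hTb : IsBLip T := ⟨⟨L, (hg.min_const N).const_max (-N)⟩, N, fun y => abs_le.2
      ⟨le_max_left _ _, max_le (by linarith) (min_le_right _ _)⟩⟩
    have hcN : hatE Pset (fun ω => T (X i ω)) ≤ c + ε * K := by
      refine hatE_le hne fun Q hQ => ?_
      calc ∫ ω, T (X i ω) ∂(Q : Measure Ω)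
          ≤ ∫ ω, (g (X i ω) + ε * g (X i ω) ^ 2) ∂(Q : Measure Ω) := by
            obtain ⟨C, hC⟩ := hTb.2
            refine integral_mono (Integrable.of_bound
              (hTb.continuous.measurable.comp (hmeas i)).aestronglyMeasurable C
              (Eventually.of_forall fun _ => hC _))
              ((hint Q hQ).add ((hint2 Q hQ).const_mul ε)) fun ω => ?_
            have := (abs_le.1 (hT (X i ω))).1
            dsimp only
            linarith
        _ ≤ c + ε * K := by
            rw [integral_add (hint Q hQ) ((hint2 Q hQ).const_mul ε), integral_const_mul]
            have := (hK Q hQ).2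
            have := hle_c Q hQ
            gcongr
    have h0 := hindep.integral_mul_nonneg hmeas i hTb hφ hφ0 hP
    set cN := hatE Pset (fun ω => T (X i ω))
    have hrest : Integrable (fun ω => B * (ε * K) + B * ε * g (X i ω) ^ 2) (P : Measure Ω) :=
      (integrable_const _).add ((hint2 P hP).const_mul (B * ε))
    have h1 : ∫ ω, φ (pastMap X i ω) * (cN - T (X i ω)) ∂(P : Measure Ω)
        ≤ ∫ ω, (φ (pastMap X i ω) * (c - g (X i ω))
          + (B * (ε * K) + B * ε * g (X i ω) ^ 2)) ∂(P : Measure Ω) := by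
      obtain ⟨C, hC⟩ := (hTb.const_sub cN).2
      refine integral_mono (Integrable.bdd_mul (c := B) (Integrable.of_bound
        ((hTb.const_sub cN).continuous.measurable.comp (hmeas i)).aestronglyMeasurable C
          (Eventually.of_forall fun _ => hC _))
        (hφ.continuous.measurable.comp (measurable_pastMap hmeas i)).aestronglyMeasurable
        (Eventually.of_forall fun _ => hB _)) (hbound.add hrest) fun ω => ?_
      have h2 := (abs_le.1 (hT (X i ω))).2
      have hφB := (abs_le.1 (hB (pastMap X i ω))).2
      have hK0 : 0 ≤ K := (integral_nonneg fun ω => sq_nonneg (g (X i ω))).trans (hK P hP).2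
      calc φ (pastMap X i ω) * (cN - T (X i ω))
          ≤ φ (pastMap X i ω) * ((c - g (X i ω)) + (ε * K + ε * g (X i ω) ^ 2)) :=
            mul_le_mul_of_nonneg_left (by linarith) (hφ0 _)
        _ = φ (pastMap X i ω) * (c - g (X i ω))
            + φ (pastMap X i ω) * (ε * K + ε * g (X i ω) ^ 2) := by ring
        _ ≤ φ (pastMap X i ω) * (c - g (X i ω)) + B * (ε * K + ε * g (X i ω) ^ 2) := by gcongr
        _ = _ := by ring
    rw [integral_add hbound hrest, integral_add (integrable_const _)
      ((hint2 P hP).const_mul (B * ε)), integral_const_mul (B * ε)] at h1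
    simp only [integral_const, probReal_univ, one_smul] at h1
    have h2 : B * ε * ∫ ω, g (X i ω) ^ 2 ∂(P : Measure Ω) ≤ B * ε * K :=
      mul_le_mul_of_nonneg_left (hK P hP).2 (by positivity)
    linarith
  refine ge_of_tendsto' (x := atTop) ?_ key
  simpa using (tendsto_one_div_add_atTop_nhds_zero_nat (𝕜 := ℝ)).const_mul (2 * B * K) |>.const_add
    (∫ ω, φ (pastMap X i ω) * (c - g (X i ω)) ∂(P : Measure Ω))

theorem HasBddMoment2.memLp {Ω : Type*} [TopologicalSpace Ω] [MeasurableSpace Ω] {d : ℕ}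
    {Pset : Set (ProbabilityMeasure Ω)} {X : Ω → EuclideanSpace ℝ (Fin d)}
    (h : HasBddMoment2 Pset X) (hX : Measurable X) {P : ProbabilityMeasure Ω} (hP : P ∈ Pset) :
    MemLp X 2 (P : Measure Ω) :=
  (memLp_two_iff_integrable_sq_norm hX.aestronglyMeasurable).2 (h.choose_spec P hP).1

theorem HasBddMoment2.exists_integral_norm_le {Ω : Type*} [TopologicalSpace Ω]
    [MeasurableSpace Ω] {d : ℕ} {Pset : Set (ProbabilityMeasure Ω)}
    {X : Ω → EuclideanSpace ℝ (Fin d)} (h : HasBddMoment2 Pset X) (hX : Measurable X) :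
    ∃ M : ℝ≥0, ∀ P ∈ Pset, ∫ ω, ‖X ω‖ ∂(P : Measure Ω) ≤ M := by
  obtain ⟨C, hC⟩ := id h
  refine ⟨(1 + C).toNNReal, fun P hP => le_trans ?_ (Real.le_coe_toNNReal _)⟩
  calc ∫ ω, ‖X ω‖ ∂(P : Measure Ω) ≤ ∫ ω, (1 + ‖X ω‖ ^ 2) ∂(P : Measure Ω) :=
        integral_mono ((h.memLp hX hP).integrable one_le_two).norm
          ((integrable_const 1).add (hC P hP).1) fun ω => by
            dsimp only
            nlinarith [sq_nonneg (‖X ω‖ - 1)]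
    _ ≤ 1 + C := by
        rw [integral_add (integrable_const 1) (hC P hP).1]
        simpa using (hC P hP).2

theorem HasBddMoment2.integral_inner_le_hatE {Ω : Type*} [TopologicalSpace Ω]
    [MeasurableSpace Ω] {d : ℕ} {Pset : Set (ProbabilityMeasure Ω)}
    {X : Ω → EuclideanSpace ℝ (Fin d)} (h : HasBddMoment2 Pset X) (hX : Measurable X)
    {P : ProbabilityMeasure Ω} (hP : P ∈ Pset) (p : EuclideanSpace ℝ (Fin d)) :
    ∫ ω, ⟪p, X ω⟫ ∂(P : Measure Ω) ≤ hatE Pset (fun ω => ⟪p, X ω⟫) := by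
  obtain ⟨M, hM⟩ := h.exists_integral_norm_le hX
  refine le_hatE (C := ‖p‖ * M) (fun Q hQ => ?_) hP
  have hi := (h.memLp hX hQ).integrable one_le_two
  calc ∫ ω, ⟪p, X ω⟫ ∂(Q : Measure Ω) ≤ ∫ ω, ‖p‖ * ‖X ω‖ ∂(Q : Measure Ω) :=
        integral_mono (hi.const_inner p) (hi.norm.const_mul _) fun ω => real_inner_le_norm _ _
    _ ≤ ‖p‖ * M := by
        rw [integral_const_mul]
        exact mul_le_mul_of_nonneg_left (hM Q hQ) (norm_nonneg p)

theorem HasBddMoment2.thetaSet_nonempty {Ω : Type*} [TopologicalSpace Ω]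
    [MeasurableSpace Ω] {d : ℕ} {Pset : Set (ProbabilityMeasure Ω)} (hne : Pset.Nonempty)
    {X : Ω → EuclideanSpace ℝ (Fin d)} (h : HasBddMoment2 Pset X) (hX : Measurable X) :
    (ThetaSet Pset X).Nonempty := by
  obtain ⟨P, hP⟩ := hne
  refine ⟨∫ ω, X ω ∂(P : Measure Ω), fun p => ?_⟩
  rw [real_inner_comm, ← integral_inner ((h.memLp hX hP).integrable one_le_two)]
  exact h.integral_inner_le_hatE hX hP p

/-- The support function `p ↦ Ê[⟨p, X⟩]` is continuous. -/
theorem HasBddMoment2.continuous_hatE_inner {Ω : Type*} [TopologicalSpace Ω]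
    [MeasurableSpace Ω] {d : ℕ} {Pset : Set (ProbabilityMeasure Ω)} (hne : Pset.Nonempty)
    {X : Ω → EuclideanSpace ℝ (Fin d)} (h : HasBddMoment2 Pset X) (hX : Measurable X) :
    Continuous fun p : EuclideanSpace ℝ (Fin d) => hatE Pset (fun ω => ⟪p, X ω⟫) := by
  obtain ⟨M, hM⟩ := h.exists_integral_norm_le hX
  refine (LipschitzWith.of_le_add_mul M fun p q => hatE_le hne fun P hP => ?_).continuous
  have hi := (h.memLp hX hP).integrable one_le_two
  calc ∫ ω, ⟪p, X ω⟫ ∂(P : Measure Ω)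
      ≤ ∫ ω, (⟪q, X ω⟫ + dist p q * ‖X ω‖) ∂(P : Measure Ω) :=
        integral_mono (hi.const_inner p) ((hi.const_inner q).add (hi.norm.const_mul _))
          fun ω => by
            have := real_inner_le_norm (p - q) (X ω)
            rw [inner_sub_left, ← dist_eq_norm] at this
            dsimp only
            linarith
    _ ≤ hatE Pset (fun ω => ⟪q, X ω⟫) + M * dist p q := by
        rw [integral_add (hi.const_inner q) (hi.norm.const_mul _), integral_const_mul, mul_comm]
        have h1 := hM P hP
        have h2 := h.integral_inner_le_hatE hX hP q
        gcongr

/-- Under every `P`, the conditional mean of `X_i` given the past lies in `Θ_i`. -/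
theorem IndepUnder.condExp_mem_thetaSet {Ω : Type*} [TopologicalSpace Ω] [MeasurableSpace Ω]
    {d n : ℕ} {Pset : Set (ProbabilityMeasure Ω)} {X : Fin n → Ω → EuclideanSpace ℝ (Fin d)}
    (hne : Pset.Nonempty) (hmeas : ∀ i, Measurable (X i)) (hmom : ∀ i, HasBddMoment2 Pset (X i))
    (hindep : IndepUnder Pset X) (i : Fin n) {P : ProbabilityMeasure Ω} (hP : P ∈ Pset) :
    ∀ᵐ ω ∂(P : Measure Ω),
      ((P : Measure Ω)[X i | MeasurableSpace.comap (pastMap X i) inferInstance]) ω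
        ∈ ThetaSet Pset (X i) := by
  have hm := (measurable_pastMap hmeas i).comap_le
  have hL2 := fun Q (hQ : Q ∈ Pset) => (hmom i).memLp (hmeas i) hQ
  obtain ⟨C, hC⟩ := id (hmom i)
  have hp : ∀ p : EuclideanSpace ℝ (Fin d), ∀ᵐ ω ∂(P : Measure Ω),
      ⟪((P : Measure Ω)[X i | MeasurableSpace.comap (pastMap X i) inferInstance]) ω, p⟫
        ≤ hatE Pset (fun ω => ⟪p, X i ω⟫) := fun p => by
    have hi := (hL2 P hP).integrable one_le_two
    have hlin := (innerSL ℝ p).comp_condExp_comm (m := MeasurableSpace.comap (pastMap X i) inferInstance) hi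
    have hpos := condExp_comap_nonneg_of_forall_isBLip (P := (P : Measure Ω))
      (measurable_pastMap hmeas i)
      (V := (fun _ => hatE Pset (fun ω => ⟪p, X i ω⟫)) - innerSL ℝ p ∘ X i)
      (measurable_const.sub ((innerSL ℝ p).measurable.comp (hmeas i)))
      ((integrable_const _).sub (hi.const_inner p)) fun φ hφ hφ0 =>
        hindep.integral_mul_nonneg_of_lipschitzWith hne hmeas i (innerSL ℝ p).lipschitz
          (K := ‖p‖ ^ 2 * C) (fun Q hQ => ⟨(hL2 Q hQ).const_inner p, by
            calc ∫ ω, ⟪p, X i ω⟫ ^ 2 ∂(Q : Measure Ω)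
                ≤ ∫ ω, ‖p‖ ^ 2 * ‖X i ω‖ ^ 2 ∂(Q : Measure Ω) :=
                  integral_mono ((hL2 Q hQ).const_inner p).integrable_sq
                    ((hC Q hQ).1.const_mul _) fun ω => by
                      dsimp only
                      rw [← mul_pow, ← sq_abs]
                      gcongr
                      exact abs_real_inner_le_norm _ _
              _ ≤ ‖p‖ ^ 2 * C := by
                  rw [integral_const_mul]
                  exact mul_le_mul_of_nonneg_left (hC Q hQ).2 (by positivity)⟩) hφ hφ0 hP
    have hsub := condExp_sub (μ := (P : Measure Ω))
      (integrable_const (hatE Pset (fun ω => ⟪p, X i ω⟫))) (hi.const_inner p)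
      (MeasurableSpace.comap (pastMap X i) inferInstance)
    rw [condExp_const hm] at hsub
    filter_upwards [hlin, hpos, hsub] with ω h1 h2 h3
    have h4 := h2.trans_eq h3
    have h5 : ⟪p, ((P : Measure Ω)[X i | MeasurableSpace.comap (pastMap X i) inferInstance]) ω⟫
      = ((P : Measure Ω)[fun ω => ⟪p, X i ω⟫ |
        MeasurableSpace.comap (pastMap X i) inferInstance]) ω := h1
    simp only [Pi.zero_apply, Pi.sub_apply, sub_nonneg] at h4
    rw [real_inner_comm, h5]
    exact h4
  obtain ⟨s, hs, hsd⟩ := TopologicalSpace.exists_countable_dense (EuclideanSpace ℝ (Fin d))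
  filter_upwards [(ae_ball_iff hs).2 fun p _ => hp p] with ω hω p
  have hclosed : IsClosed {p : EuclideanSpace ℝ (Fin d) |
      ⟪((P : Measure Ω)[X i | MeasurableSpace.comap (pastMap X i) inferInstance]) ω, p⟫
        ≤ hatE Pset (fun ω => ⟪p, X i ω⟫)} :=
    isClosed_le (by fun_prop) ((hmom i).continuous_hatE_inner hne (hmeas i))
  exact hclosed.closure_subset_iff.2 hω (hsd p)

/-- Pythagoras' identity for the errors of predicting each map from its predecessors. -/
theorem integral_norm_sum_sub_condExp_sq {Ω E : Type*} [NormedAddCommGroup E]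
    [InnerProductSpace ℝ E] [CompleteSpace E] [SecondCountableTopology E] [MeasurableSpace E]
    [BorelSpace E] [MeasurableSpace Ω] {P : Measure Ω} [IsFiniteMeasure P] {n : ℕ}
    {X : Fin n → Ω → E} (hmeas : ∀ i, Measurable (X i)) (hX : ∀ i, MemLp (X i) 2 P)
    {D : Fin n → Ω → E}
    (hD : ∀ i, D i = X i - P[X i | MeasurableSpace.comap (pastMap X i) inferInstance]) :
    ∫ ω, ‖∑ i, D i ω‖ ^ 2 ∂P = ∑ i, ∫ ω, ‖D i ω‖ ^ 2 ∂P := by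
  have hDL : ∀ i, MemLp (D i) 2 P := fun i => by
    rw [hD]; exact (hX i).sub ((hX i).condExp one_le_two)
  have hlt : ∀ i j, i < j → ∫ ω, ⟪D i ω, D j ω⟫ ∂P = 0 := fun i j hij => by
    have hm : StronglyMeasurable[MeasurableSpace.comap (pastMap X j) inferInstance] (D i) := by
      rw [hD]
      exact (measurable_comap_pastMap X hij).stronglyMeasurable.sub
        (stronglyMeasurable_condExp.mono (comap_pastMap_mono X hij.le))
    have := integral_inner_sub_condExp_eq_zero (measurable_pastMap hmeas j).comap_le
      (hX j) (hDL i) hm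
    rw [hD j]
    exact this
  simp_rw [← real_inner_self_eq_norm_sq, sum_inner, inner_sum]
  rw [integral_finsetSum _ fun i _ => integrable_finsetSum _ fun j _ =>
    (hDL i).integrable_inner_real (hDL j)]
  refine Finset.sum_congr rfl fun i _ => ?_
  rw [integral_finsetSum _ fun j _ => (hDL i).integrable_inner_real (hDL j)]
  refine Finset.sum_eq_single i (fun j _ hji => ?_) (by simp)
  rcases lt_or_gt_of_ne hji with h | h
  · exact (integral_congr_ae (Eventually.of_forall fun ω => real_inner_comm _ _)).trans
      (hlt j i h)
  · exact hlt i j h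

/-- `Ê[ρ_Θ²((1/n) ∑ X_i)] ≤ σ̄_n²/n` for independent `X_1, …, X_n`
(0-indexed here) with uniformly bounded second moments. -/
theorem hatE_sq_infDist_sample_mean_le
    {Ω : Type*} [MetricSpace Ω] [CompleteSpace Ω] [TopologicalSpace.SeparableSpace Ω]
    [MeasurableSpace Ω] [BorelSpace Ω]
    {d n : ℕ} (hn : 0 < n) (Pset : Set (ProbabilityMeasure Ω))
    (hne : Pset.Nonempty) (hconv : ConvexPM Pset) (hcomp : IsCompact Pset)
    (X : Fin n → Ω → EuclideanSpace ℝ (Fin d))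
    (hmeas : ∀ i, Measurable (X i))
    (hmom : ∀ i, HasBddMoment2 Pset (X i))
    (hindep : IndepUnder Pset X)
    (Θ : Set (EuclideanSpace ℝ (Fin d)))
    (hΘ : Θ = {x | ∃ θ : Fin n → EuclideanSpace ℝ (Fin d),
      (∀ i, θ i ∈ ThetaSet Pset (X i)) ∧ x = (n : ℝ)⁻¹ • ∑ i, θ i})
    (σbar2 : ℝ)
    (hσ : σbar2 = ⨆ i : Fin n, sInf {v : ℝ | ∃ θ ∈ ThetaSet Pset (X i),
      v = hatE Pset (fun ω => ‖X i ω - θ‖ ^ 2)}) :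
    hatE Pset (fun ω => (Metric.infDist ((n : ℝ)⁻¹ • ∑ i, X i ω) Θ) ^ 2)
      ≤ σbar2 / n := by
  subst hΘ hσ
  set v : Fin n → ℝ := fun i => sInf {v : ℝ | ∃ θ ∈ ThetaSet Pset (X i),
    v = hatE Pset (fun ω => ‖X i ω - θ‖ ^ 2)}
  have hn0 : (0 : ℝ) < n := by exact_mod_cast hn
  refine hatE_le hne fun P hP => ?_
  have hX : ∀ i, ∀ Q ∈ Pset, MemLp (X i) 2 (Q : Measure Ω) :=
    fun i Q hQ => (hmom i).memLp (hmeas i) hQ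
  set M : Fin n → Ω → EuclideanSpace ℝ (Fin d) := fun i =>
    (P : Measure Ω)[X i | MeasurableSpace.comap (pastMap X i) inferInstance]
  set D : Fin n → Ω → EuclideanSpace ℝ (Fin d) := fun i => X i - M i
  have hDL : ∀ i, MemLp (D i) 2 (P : Measure Ω) := fun i =>
    (hX i P hP).sub ((hX i P hP).condExp one_le_two)
  have hDv : ∀ i, ∫ ω, ‖D i ω‖ ^ 2 ∂(P : Measure Ω) ≤ v i := fun i => by
    obtain ⟨θ₀, hθ₀⟩ := (hmom i).thetaSet_nonempty hne (hmeas i)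
    refine le_csInf ⟨_, θ₀, hθ₀, rfl⟩ ?_
    rintro _ ⟨θ, -, rfl⟩
    refine (integral_norm_sub_condExp_sq_le (measurable_pastMap hmeas i).comap_le
      (hX i P hP) θ).trans ?_
    obtain ⟨C, hC⟩ := hmom i
    refine le_hatE (C := 2 * C + 2 * ‖θ‖ ^ 2) (fun Q hQ => ?_) hP
    have hi : Integrable (fun ω => 2 * ‖X i ω‖ ^ 2) (Q : Measure Ω) := (hC Q hQ).1.const_mul 2
    calc ∫ ω, ‖X i ω - θ‖ ^ 2 ∂(Q : Measure Ω)
        ≤ ∫ ω, (2 * ‖X i ω‖ ^ 2 + 2 * ‖θ‖ ^ 2) ∂(Q : Measure Ω) :=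
          integral_mono_of_nonneg (Eventually.of_forall fun ω => by positivity)
            (hi.add (integrable_const _)) (Eventually.of_forall fun ω => by
              have h1 := norm_sub_le (X i ω) θ
              have h2 := pow_le_pow_left₀ (norm_nonneg _) h1 2
              dsimp only
              nlinarith [sq_nonneg (‖X i ω‖ - ‖θ‖)])
      _ ≤ 2 * C + 2 * ‖θ‖ ^ 2 := by
          rw [integral_add hi (integrable_const _), integral_const_mul]
          simpa using (hC Q hQ).2
  have hsum : Integrable (fun ω => ((n : ℝ)⁻¹) ^ 2 * ‖∑ i, D i ω‖ ^ 2) (P : Measure Ω) :=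
    ((memLp_finsetSum Finset.univ fun i _ => hDL i).integrable_norm_pow two_ne_zero).const_mul _
  calc ∫ ω, (Metric.infDist ((n : ℝ)⁻¹ • ∑ i, X i ω) _) ^ 2 ∂(P : Measure Ω)
      ≤ ∫ ω, ((n : ℝ)⁻¹) ^ 2 * ‖∑ i, D i ω‖ ^ 2 ∂(P : Measure Ω) := by
        refine integral_mono_of_nonneg (Eventually.of_forall fun ω => by positivity) hsum ?_
        filter_upwards [ae_all_iff.2 fun i =>
          hindep.condExp_mem_thetaSet hne hmeas hmom i hP] with ω hω
        rw [← mul_pow]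
        refine pow_le_pow_left₀ Metric.infDist_nonneg ?_ 2
        have hmem : (n : ℝ)⁻¹ • ∑ i, M i ω ∈ {x | ∃ θ : Fin n → EuclideanSpace ℝ (Fin d),
            (∀ i, θ i ∈ ThetaSet Pset (X i)) ∧ x = (n : ℝ)⁻¹ • ∑ i, θ i} :=
          ⟨fun i => M i ω, hω, rfl⟩
        refine (Metric.infDist_le_dist_of_mem hmem).trans_eq ?_
        rw [dist_eq_norm, ← smul_sub, norm_smul, ← Finset.sum_sub_distrib,
          Real.norm_of_nonneg (by positivity)]
        rfl
    _ = ((n : ℝ)⁻¹) ^ 2 * ∑ i, ∫ ω, ‖D i ω‖ ^ 2 ∂(P : Measure Ω) := by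
        rw [integral_const_mul, integral_norm_sum_sub_condExp_sq hmeas (fun i => hX i P hP)
          fun i => rfl]
    _ ≤ ((n : ℝ)⁻¹) ^ 2 * ∑ _i : Fin n, ⨆ i, v i := by
        gcongr with i
        exact (hDv i).trans (le_ciSup (finite_range v).bddAbove i)
    _ = (⨆ i, v i) / n := by
        rw [Finset.sum_const, Finset.card_univ, Fintype.card_fin, nsmul_eq_mul]
        field_simp
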